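/- Let (X, B_X, μ) be a Gaussian probability space, and let X̃ ⊆ X be a linear subspace carrying a norm making it a separable Banach space continuously embedded in X, with X̃ ∈ B_X, μ(X̃) = 1, and B_{X̃} = {A ∩ X̃ : A ∈ B_X}. Then the restriction μ̃ := μ|_{X̃} is a Gaussian measure on X̃. -/

import Mathlib

open MeasureTheory ProbabilityTheory

/-- A probability measure on a Banach space is (centered) Gaussian if every continuous
linear functional has a centered Gaussian distribution. -/
def IsGaussianMeasure {X : Type*} [NormedAddCommGroup X] [NormedSpace ℝ X]
    [MeasurableSpace X] (μ : Measure X) : Prop :=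
  ∀ φ : X →L[ℝ] ℝ, ∃ v : NNReal, Measure.map φ μ = gaussianReal 0 v

open scoped Real

lemma memLp_two_id_of_map_rotation_eq_self {ν : Measure ℝ} [IsFiniteMeasure ν]
    (h : (ν.prod ν).map (ContinuousLinearMap.rotation (-(π / 4))) = ν.prod ν) :
    MemLp id 2 ν := by
  obtain ⟨C, hC, hint⟩ := exists_integrable_exp_sq_of_map_rotation_eq_self h
  refine (memLp_two_iff_integrable_sq (by fun_prop)).2
    ((hint.const_mul C⁻¹).mono' (by fun_prop) (ae_of_all _ fun x ↦ ?_))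
  simp only [id_eq, norm_pow, Real.norm_eq_abs]
  rw [inv_mul_eq_div, le_div_iff₀ hC]
  linarith [Real.add_one_le_exp (C * |x| ^ 2)]

lemma map_inv_sqrt_two_mul_add_eq_self {ν : Measure ℝ} [IsProbabilityMeasure ν]
    (h : (ν.prod ν).map (ContinuousLinearMap.rotation (-(π / 4))) = ν.prod ν) :
    (ν.prod ν).map (fun p ↦ (√2)⁻¹ * (p.1 + p.2)) = ν := by
  calc (ν.prod ν).map (fun p ↦ (√2)⁻¹ * (p.1 + p.2))
  _ = ((ν.prod ν).map (ContinuousLinearMap.rotation (-(π / 4)))).map Prod.snd := by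
    rw [Measure.map_map (by fun_prop) (by fun_prop)]
    congr 1
    ext p
    simp [ContinuousLinearMap.rotation_apply, ← Real.sqrt_div_self]
    ring
  _ = ν := by rw [h, measurePreserving_snd.map_eq]

lemma charFun_eq_pow_two_pow {ν : Measure ℝ} [IsProbabilityMeasure ν]
    (h : (ν.prod ν).map (fun p ↦ (√2)⁻¹ * (p.1 + p.2)) = ν) (n : ℕ) (t : ℝ) :
    charFun ν t = charFun ν ((√(2 ^ n : ℕ))⁻¹ * t) ^ (2 ^ n) := by
  have hsq (s : ℝ) : charFun ν s = charFun ν ((√2)⁻¹ * s) ^ 2 := by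
    conv_lhs => rw [← h]
    rw [charFun_map_mul_comp (by fun_prop), charFun_map_add_prod_eq_mul, Pi.mul_apply, sq]
  induction n with
  | zero => simp
  | succ n ih =>
    rw [ih, hsq, ← pow_mul, ← pow_succ']
    congr 2
    push_cast
    rw [pow_succ, Real.sqrt_mul (by positivity), mul_inv]
    ring

lemma integral_id_eq_zero_of_map_inv_sqrt_two_mul_add_eq_self {ν : Measure ℝ}
    [IsProbabilityMeasure ν] (hint : Integrable (fun x ↦ x) ν)
    (h : (ν.prod ν).map (fun p ↦ (√2)⁻¹ * (p.1 + p.2)) = ν) :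
    ∫ x, x ∂ν = 0 := by
  have hmean : ∫ x, x ∂ν = (√2)⁻¹ * (∫ x, x ∂ν + ∫ x, x ∂ν) := by
    conv_lhs => rw [← h]
    rw [integral_map (by fun_prop) (by fun_prop), integral_const_mul,
      integral_add (hint.comp_fst ν) (hint.comp_snd ν)]
    simp [integral_fun_fst (fun x : ℝ ↦ x), integral_fun_snd (fun x : ℝ ↦ x)]
  have hpos : (0 : ℝ) < √2 := by positivity
  have hlt : √2 < 2 := by
    rw [Real.sqrt_lt' (by norm_num)]
    norm_num
  rw [inv_mul_eq_div, eq_div_iff hpos.ne'] at hmean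
  have : (∫ x, x ∂ν) * (2 - √2) = 0 := by linarith
  exact (mul_eq_zero.1 this).resolve_right (by linarith)

/-- A probability measure on `ℝ` whose square is invariant under rotation of angle `-π/4` is a
centered Gaussian. -/
theorem exists_eq_gaussianReal_of_map_rotation_eq_self {ν : Measure ℝ} [IsProbabilityMeasure ν]
    (h : (ν.prod ν).map (ContinuousLinearMap.rotation (-(π / 4))) = ν.prod ν) :
    ∃ v : NNReal, ν = gaussianReal 0 v := by
  have hL2 := memLp_two_id_of_map_rotation_eq_self h
  have hadd := map_inv_sqrt_two_mul_add_eq_self h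
  have hmean := integral_id_eq_zero_of_map_inv_sqrt_two_mul_add_eq_self
    (hL2.integrable (by norm_num)) hadd
  obtain hv | hv := (variance_nonneg id ν).eq_or_lt'
  · refine ⟨0, ?_⟩
    have hae := ae_eq_integral_of_variance_eq_zero hL2 hv
    simp only [id_eq, hmean] at hae
    calc ν = ν.map (fun x ↦ x) := Measure.map_id'.symm
    _ = gaussianReal 0 0 := by simp [Measure.map_congr hae, Measure.map_const]
  · have hsq : ∫ x, x ^ 2 ∂ν = Var[id; ν] := by
      rw [variance_of_integral_eq_zero (by fun_prop) (by simpa using hmean)]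
      rfl
    refine ⟨Var[id; ν].toNNReal, Measure.ext_of_charFun (funext fun t ↦ ?_)⟩
    set σ := √Var[id; ν] with hσ
    have hσ0 : 0 < σ := Real.sqrt_pos.2 hv
    have hσsq : σ ^ 2 = Var[id; ν] := Real.sq_sqrt hv.le
    have hlim := (tendsto_charFun_inv_sqrt_mul_pow (P := ν) (X := fun x ↦ σ⁻¹ * x) (by fun_prop)
      (by rw [integral_const_mul, hmean, mul_zero])
      (by simp [mul_pow, integral_const_mul, hsq, ← hσsq, hσ0.ne']) (σ * t)).comp
      (tendsto_pow_atTop_atTop_of_one_lt one_lt_two)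
    have hconst (n : ℕ) : charFun (ν.map (fun x ↦ σ⁻¹ * x)) ((√(2 ^ n : ℕ))⁻¹ * (σ * t)) ^ (2 ^ n)
        = charFun ν t := by
      rw [charFun_map_mul, charFun_eq_pow_two_pow hadd n t]
      congr 2
      field_simp
    simp only [Function.comp_def, hconst] at hlim
    rw [tendsto_nhds_unique tendsto_const_nhds hlim, charFun_gaussianReal,
      Real.coe_toNNReal _ hv.le, ← hσsq]
    congr 1
    push_cast
    ring

lemma IsGaussianMeasure.map_rotation_eq_self {X : Type*} [NormedAddCommGroup X] [NormedSpace ℝ X]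
    [CompleteSpace X] [SecondCountableTopology X] [MeasurableSpace X] [BorelSpace X]
    {μ : Measure X} (hμ : IsGaussianMeasure μ) (θ : ℝ) :
    (μ.prod μ).map (ContinuousLinearMap.rotation θ) = μ.prod μ := by
  have : IsGaussian μ := isGaussian_of_map_eq_gaussianReal fun L ↦ ⟨0, hμ L⟩
  refine IsGaussian.map_rotation_eq_self_of_forall_strongDual_eq_zero (fun L ↦ ?_) θ
  obtain ⟨v, hv⟩ := hμ L
  have hint : ∫ x, x ∂(μ.map L) = μ[L] := integral_map (by fun_prop) (by fun_prop)
  rw [← hint, hv, integral_id_gaussianReal]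

lemma ContinuousLinearMap.rotation_comp_prodMap {E F : Type*} [NormedAddCommGroup E]
    [NormedSpace ℝ E] [NormedAddCommGroup F] [NormedSpace ℝ F] (L : E →L[ℝ] F) (θ : ℝ) :
    rotation θ ∘ Prod.map L L = Prod.map L L ∘ rotation θ := by
  ext p <;> simp [rotation_apply]

lemma map_rotation_map_eq_self {E F : Type*} [NormedAddCommGroup E] [NormedSpace ℝ E]
    [SecondCountableTopology E] [MeasurableSpace E] [BorelSpace E] [NormedAddCommGroup F]
    [NormedSpace ℝ F] [SecondCountableTopology F] [MeasurableSpace F] [BorelSpace F]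
    {ν : Measure E} [SFinite ν] (L : E →L[ℝ] F) {θ : ℝ}
    (h : (ν.prod ν).map (ContinuousLinearMap.rotation θ) = ν.prod ν) :
    ((ν.map L).prod (ν.map L)).map (ContinuousLinearMap.rotation θ) =
      (ν.map L).prod (ν.map L) := by
  have hL : Measurable (Prod.map L L) := by fun_prop
  rw [Measure.map_prod_map _ _ (by fun_prop) (by fun_prop), Measure.map_map (by fun_prop) hL,
    L.rotation_comp_prodMap, ← Measure.map_map hL (by fun_prop), h]

lemma map_rotation_eq_self_of_map {E F : Type*} [NormedAddCommGroup E] [NormedSpace ℝ E]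
    [SecondCountableTopology E] [MeasurableSpace E] [BorelSpace E] [NormedAddCommGroup F]
    [NormedSpace ℝ F] [SecondCountableTopology F] [MeasurableSpace F] [BorelSpace F]
    {ν : Measure E} [SFinite ν] {L : E →L[ℝ] F} (hL : MeasurableEmbedding L) {θ : ℝ}
    (h : ((ν.map L).prod (ν.map L)).map (ContinuousLinearMap.rotation θ) =
      (ν.map L).prod (ν.map L)) :
    (ν.prod ν).map (ContinuousLinearMap.rotation θ) = ν.prod ν := by
  have hLL : MeasurableEmbedding (Prod.map L L) := hL.prodMap hL
  rw [Measure.map_prod_map _ _ hL.measurable hL.measurable,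
    Measure.map_map (by fun_prop) hLL.measurable, L.rotation_comp_prodMap,
    ← Measure.map_map hLL.measurable (by fun_prop)] at h
  rw [← hLL.comap_map ((ν.prod ν).map _), h, hLL.comap_map]

theorem restriction_of_gaussian_is_gaussian
    (X : Type*) [NormedAddCommGroup X] [NormedSpace ℝ X] [CompleteSpace X]
    [TopologicalSpace.SeparableSpace X] [MeasurableSpace X] [BorelSpace X]
    (Y : Type*) [NormedAddCommGroup Y] [NormedSpace ℝ Y] [CompleteSpace Y]
    [TopologicalSpace.SeparableSpace Y] [MeasurableSpace Y] [BorelSpace Y]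
    (μ : Measure X) [IsProbabilityMeasure μ] (hμ : IsGaussianMeasure μ)
    (ι : Y →L[ℝ] X) (hinj : Function.Injective ι)
    (himg : ∀ s : Set Y, MeasurableSet s → MeasurableSet (ι '' s))
    (htrace : ∀ s : Set Y, MeasurableSet s ↔ ∃ A : Set X, MeasurableSet A ∧ ι ⁻¹' A = s)
    (hfull : μ (Set.range ι) = 1) :
    IsGaussianMeasure (Measure.comap ι μ) := by
  have : SecondCountableTopology X := UniformSpace.secondCountable_of_separable X
  have : SecondCountableTopology Y := UniformSpace.secondCountable_of_separable Y
  have hι : MeasurableEmbedding ι := ⟨hinj, ι.continuous.measurable, fun {s} ↦ himg s⟩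
  have hmap : (μ.comap ι).map ι = μ := by
    rw [hι.map_comap, Measure.restrict_eq_self_of_ae_mem]
    exact (prob_compl_eq_zero_iff hι.measurableSet_range).2 hfull
  have : IsProbabilityMeasure (μ.comap ι) :=
    ⟨by rw [hι.comap_apply, Set.image_univ, hfull]⟩
  intro φ
  have : IsProbabilityMeasure ((μ.comap ι).map φ) :=
    Measure.isProbabilityMeasure_map (by fun_prop)
  refine exists_eq_gaussianReal_of_map_rotation_eq_self (map_rotation_map_eq_self φ ?_)
  refine map_rotation_eq_self_of_map hι ?_
  rw [hmap]
  exact hμ.map_rotation_eq_self _
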